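/- (Weak duality for ℓ1-regularized AdaBoost.) For every primal-feasible w ∈ ℝ^N (i.e. w_j ≥ 0 for all j and ∑_{j=1}^N w_j = 1/T) and every dual-feasible pair (r, u) ∈ ℝ × ℝ^M (i.e. u_i ≥ 0 for all i, ∑_{i=1}^M u_i = 1, and ∑_{i=1}^M u_i y_i H_{ij} ≤ −r for all j = 1,…,N), one has r/T − ∑_{i=1}^M u_i log u_i ≤ log( ∑_{i=1}^M exp( −y_i ∑_{j=1}^N H_{ij} w_j ) ). -/

import Mathlib

/-- Gibbs variational inequality: expected score plus entropy is bounded by log-sum-exp. -/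
theorem sum_mul_sub_sum_mul_log_le_log_sum_exp {ι : Type*} [Fintype ι] (u z : ι → ℝ)
    (hu : ∀ i, 0 ≤ u i) (hu_sum : ∑ i, u i = 1) :
    ∑ i, u i * z i - ∑ i, u i * Real.log (u i) ≤ Real.log (∑ i, Real.exp (z i)) := by
  have hι : Nonempty ι := by
    by_contra h
    rw [not_nonempty_iff] at h
    simp at hu_sum
  have hpos : 0 < ∑ i, Real.exp (z i) :=
    Finset.sum_pos (fun i _ => Real.exp_pos _) Finset.univ_nonempty
  set L := Real.log (∑ i, Real.exp (z i)) with hL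
  have hpt (i : ι) : u i * z i - u i * Real.log (u i) - u i * L ≤ Real.exp (z i - L) - u i := by
    rcases (hu i).eq_or_lt with h | h
    · simp [← h, Real.exp_nonneg]
    · have hexp : u i * Real.exp (z i - L - Real.log (u i)) = Real.exp (z i - L) := by
        rw [Real.exp_sub _ (Real.log (u i)), Real.exp_log h]
        field_simp
      have := mul_le_mul_of_nonneg_left
        (Real.add_one_le_exp (z i - L - Real.log (u i))) h.le
      rw [hexp] at this
      linarith
  have hnorm : ∑ i, Real.exp (z i - L) = 1 := by
    simp_rw [Real.exp_sub]
    rw [← Finset.sum_div, hL, Real.exp_log hpos, div_self hpos.ne']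
  have hsum := Finset.sum_le_sum fun i (_ : i ∈ Finset.univ) => hpt i
  simp only [Finset.sum_sub_distrib, ← Finset.sum_mul, hnorm, hu_sum] at hsum
  linarith

/-- Weak duality for ℓ1-regularized AdaBoost: any dual-feasible objective value is
at most any primal-feasible objective value. -/
theorem adaboost_l1_weak_duality (M N : ℕ) (hM : 0 < M) (hN : 0 < N)
    (H : Fin M → Fin N → ℝ) (y : Fin M → ℝ) (hy : ∀ i, y i = 1 ∨ y i = -1)
    (T : ℝ) (hT : 0 < T)
    (w : Fin N → ℝ) (hw_nonneg : ∀ j, 0 ≤ w j) (hw_sum : ∑ j, w j = 1 / T)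
    (r : ℝ) (u : Fin M → ℝ) (hu_nonneg : ∀ i, 0 ≤ u i) (hu_sum : ∑ i, u i = 1)
    (hedge : ∀ j, ∑ i, u i * y i * H i j ≤ - r) :
    r / T - ∑ i, u i * Real.log (u i)
      ≤ Real.log (∑ i, Real.exp (- y i * ∑ j, H i j * w j)) := by
  have hmargin : r / T ≤ ∑ i, u i * (- y i * ∑ j, H i j * w j) := by
    calc r / T = ∑ j, w j * r := by rw [← Finset.sum_mul, hw_sum]; ring
      _ ≤ ∑ j, w j * -∑ i, u i * y i * H i j :=
        Finset.sum_le_sum fun j _ =>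
          mul_le_mul_of_nonneg_left (le_neg_of_le_neg (hedge j)) (hw_nonneg j)
      _ = ∑ i, u i * (- y i * ∑ j, H i j * w j) := by
        simp only [← Finset.sum_neg_distrib, Finset.mul_sum]
        rw [Finset.sum_comm]
        exact Finset.sum_congr rfl fun i _ => Finset.sum_congr rfl fun j _ => by ring
  have := sum_mul_sub_sum_mul_log_le_log_sum_exp u
    (fun i => - y i * ∑ j, H i j * w j) hu_nonneg hu_sum
  linarith
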